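/- Let α ∈ ℝ and let F : ℝ^{m₁×m₂} × ℝ → ℝ^{m₁×m₂} satisfy ⟨F(Y,t), Y⟩ ≤ α‖Y‖_F² for all Y and t. Let Δt ≥ 0 with αΔt < 1. Suppose (X̂ⁿ)_{n≥0} is a sequence of matrices in ℝ^{m₁×m₂} such that for each n there exist matrices Ũₙ ∈ ℝ^{m₁×s₁⁽ⁿ⁾}, Ṽₙ ∈ ℝ^{m₂×s₂⁽ⁿ⁾} with orthonormal columns, a time tₙ₊₁ ∈ ℝ, and Σ̃ₙ with Σ̃ₙ = Ũₙᵀ (X̂ⁿ + Δt · F(Ũₙ Σ̃ₙ Ṽₙᵀ, tₙ₊₁)) Ṽₙ and ‖X̂ⁿ⁺¹‖_F ≤ ‖Ũₙ Σ̃ₙ Ṽₙᵀ‖_F. Then for every n, ‖X̂ⁿ‖_F ≤ (1 − αΔt)⁻ⁿ ‖X̂⁰‖_F. -/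

import Mathlib

open Matrix

/-- Frobenius inner product of two real matrices. -/
noncomputable def finner {m₁ m₂ : ℕ} (A B : Matrix (Fin m₁) (Fin m₂) ℝ) : ℝ :=
  ∑ i, ∑ j, A i j * B i j

/-- Frobenius norm of a real matrix. -/
noncomputable def fnorm {m₁ m₂ : ℕ} (A : Matrix (Fin m₁) (Fin m₂) ℝ) : ℝ :=
  Real.sqrt (finner A A)

lemma finner_eq_trace {m₁ m₂ : ℕ} (A B : Matrix (Fin m₁) (Fin m₂) ℝ) :
    finner A B = (Aᵀ * B).trace := by
  simp only [finner, trace, diag_apply, mul_apply, transpose_apply]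
  exact Finset.sum_comm

lemma finner_self_nonneg {m₁ m₂ : ℕ} (A : Matrix (Fin m₁) (Fin m₂) ℝ) : 0 ≤ finner A A :=
  Finset.sum_nonneg fun _ _ => Finset.sum_nonneg fun _ _ => mul_self_nonneg _

lemma fnorm_nonneg {m₁ m₂ : ℕ} (A : Matrix (Fin m₁) (Fin m₂) ℝ) : 0 ≤ fnorm A :=
  Real.sqrt_nonneg _

lemma fnorm_sq {m₁ m₂ : ℕ} (A : Matrix (Fin m₁) (Fin m₂) ℝ) : fnorm A ^ 2 = finner A A :=
  Real.sq_sqrt (finner_self_nonneg A)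

/-- Cauchy–Schwarz inequality for the Frobenius inner product. -/
lemma finner_le_fnorm_mul_fnorm {m₁ m₂ : ℕ} (A B : Matrix (Fin m₁) (Fin m₂) ℝ) :
    finner A B ≤ fnorm A * fnorm B := by
  have h := Real.sum_mul_le_sqrt_mul_sqrt Finset.univ
    (fun p : Fin m₁ × Fin m₂ => A p.1 p.2) (fun p => B p.1 p.2)
  simpa only [Fintype.sum_prod_type, pow_two, fnorm, finner] using h

lemma finner_add_smul_left {m₁ m₂ : ℕ} (A B C : Matrix (Fin m₁) (Fin m₂) ℝ) (c : ℝ) :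
    finner (A + c • B) C = finner A C + c * finner B C := by
  simp [finner_eq_trace, Matrix.add_mul]

/-- A Galerkin solution has the same Frobenius inner product with itself as with the matrix
it projects. -/
lemma finner_self_galerkin {m₁ m₂ s₁ s₂ : ℕ} {U : Matrix (Fin m₁) (Fin s₁) ℝ}
    {V : Matrix (Fin m₂) (Fin s₂) ℝ} {S : Matrix (Fin s₁) (Fin s₂) ℝ}
    {Z : Matrix (Fin m₁) (Fin m₂) ℝ} (hU : Uᵀ * U = 1) (hV : Vᵀ * V = 1)
    (hS : S = Uᵀ * Z * V) :
    finner (U * S * Vᵀ) (U * S * Vᵀ) = finner Z (U * S * Vᵀ) := by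
  have key (W : Matrix (Fin m₁) (Fin m₂) ℝ) :
      finner W (U * S * Vᵀ) = finner (Uᵀ * W * V) S := by
    rw [finner_eq_trace, finner_eq_trace, ← Matrix.mul_assoc, trace_mul_comm]
    simp only [transpose_mul, transpose_transpose, Matrix.mul_assoc]
  have hproj : Uᵀ * (U * S * Vᵀ) * V = S := by
    calc Uᵀ * (U * S * Vᵀ) * V = (Uᵀ * U) * S * (Vᵀ * V) := by
          simp only [Matrix.mul_assoc]
      _ = S := by rw [hU, hV, Matrix.one_mul, Matrix.mul_one]
  rw [key, key, hproj, ← hS]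

theorem stmt_2 {m₁ m₂ : ℕ} (α : ℝ)
    (F : Matrix (Fin m₁) (Fin m₂) ℝ → ℝ → Matrix (Fin m₁) (Fin m₂) ℝ)
    (hF : ∀ Y t, finner (F Y t) Y ≤ α * (fnorm Y) ^ 2)
    (Δt : ℝ) (hΔt : 0 ≤ Δt) (hαΔt : α * Δt < 1)
    (X : ℕ → Matrix (Fin m₁) (Fin m₂) ℝ)
    (hstep : ∀ n : ℕ, ∃ (s₁ s₂ : ℕ) (U : Matrix (Fin m₁) (Fin s₁) ℝ)
      (V : Matrix (Fin m₂) (Fin s₂) ℝ) (t : ℝ) (S : Matrix (Fin s₁) (Fin s₂) ℝ),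
        Uᵀ * U = 1 ∧ Vᵀ * V = 1 ∧
        S = Uᵀ * (X n + Δt • F (U * S * Vᵀ) t) * V ∧
        fnorm (X (n + 1)) ≤ fnorm (U * S * Vᵀ)) :
    ∀ n : ℕ, fnorm (X n) ≤ ((1 - α * Δt)⁻¹) ^ n * fnorm (X 0) := by
  have hpos : 0 < 1 - α * Δt := by linarith
  intro n
  induction n with
  | zero => simp
  | succ n ih =>
    obtain ⟨s₁, s₂, U, V, t, S, hU, hV, hS, hX⟩ := hstep n
    have hG := finner_self_galerkin hU hV hS
    generalize U * S * Vᵀ = Y at hG hX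
    rw [finner_add_smul_left, ← fnorm_sq] at hG
    have hCS := finner_le_fnorm_mul_fnorm (X n) Y
    have hFY := mul_le_mul_of_nonneg_left (hF Y t) hΔt
    have hY : (1 - α * Δt) * fnorm Y ≤ fnorm (X n) := by
      rcases (fnorm_nonneg Y).eq_or_lt with h | h
      · rw [← h, mul_zero]
        exact fnorm_nonneg _
      · refine le_of_mul_le_mul_right ?_ h
        linarith
    calc fnorm (X (n + 1)) ≤ fnorm Y := hX
      _ ≤ (1 - α * Δt)⁻¹ * fnorm (X n) := (le_inv_mul_iff₀ hpos).2 hY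
      _ ≤ (1 - α * Δt)⁻¹ * (((1 - α * Δt)⁻¹) ^ n * fnorm (X 0)) :=
        mul_le_mul_of_nonneg_left ih (inv_nonneg.2 hpos.le)
      _ = ((1 - α * Δt)⁻¹) ^ (n + 1) * fnorm (X 0) := by ring
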